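/- Let a : [c,d] → (0,∞), γ : [c,d] → (0,∞), b : [c,d] → ℝⁿ be smooth and suppose F(a,γ) := γ(ä + 32a³ - 3ȧ²/(2a) - (a/2)(ȧ/a + γ̇/γ)²) > 0 on [c,d]. Then for every Schwartz function f and every t ∈ [c,d], ⟨γS_t f + γ[S,A]f + γ̇Sf, f⟩ ≥ -(γ²a²|b̈|²/F(a,γ)) ‖f‖², where S, A are the operators associated to a, b as in the conjugated Schrödinger operator. -/

import Mathlib

open Set MeasureTheory

/-- Partial derivative in the `i`-th coordinate. -/
noncomputable def pd (n : ℕ) (i : Fin n) (f : (Fin n → ℝ) → ℂ) (x : Fin n → ℝ) : ℂ :=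
  deriv (fun s => f (Function.update x i s)) (x i)

/-- Spatial Laplacian on `ℝⁿ`. -/
noncomputable def lap (n : ℕ) (f : (Fin n → ℝ) → ℂ) (x : Fin n → ℝ) : ℂ :=
  ∑ i, pd n i (pd n i f) x

open scoped SchwartzMap LineDeriv

section Weyl

variable {R : Type*} [Ring R] {n : ℕ} {X D : Fin n → R}

theorem euler_commutator_laplacian (hDD : ∀ i j, D i * D j = D j * D i)
    (hDX : ∀ i j, D i * X j = X j * D i + if i = j then 1 else 0) :
    (∑ i, X i * D i) * (∑ j, D j * D j) - (∑ j, D j * D j) * (∑ i, X i * D i) =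
      -(2 * ∑ i, D i * D i) := by
  have key : ∀ i j, X i * D i * (D j * D j) - D j * D j * (X i * D i) =
      if i = j then -(2 * (D i * D i)) else 0 := by
    intro i j
    have h : D j * D j * (X i * D i) = X i * D i * (D j * D j) +
        2 * (if j = i then D j * D i else 0) := by
      calc D j * D j * (X i * D i) = D j * (D j * X i) * D i := by noncomm_ring
        _ = D j * (X i * D j + if j = i then 1 else 0) * D i := by rw [hDX]
        _ = (D j * X i) * (D j * D i) + D j * (if j = i then 1 else 0) * D i := by
            split_ifs <;> noncomm_ring
        _ = X i * (D j * (D j * D i)) + (if j = i then 1 else 0) * (D j * D i) +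
            D j * (if j = i then 1 else 0) * D i := by
            rw [hDX]; split_ifs <;> noncomm_ring
        _ = X i * D i * (D j * D j) + (if j = i then 1 else 0) * (D j * D i) +
            D j * (if j = i then 1 else 0) * D i := by
            rw [hDD j i, ← mul_assoc (D j) (D i), hDD j i]; noncomm_ring
        _ = _ := by split_ifs <;> noncomm_ring
    rw [h]
    by_cases hij : i = j
    · subst hij; simp
    · simp [hij, Ne.symm hij]
  rw [Finset.sum_mul_sum, Finset.sum_mul_sum, Finset.sum_comm, ← Finset.sum_sub_distrib]
  simp_rw [← Finset.sum_sub_distrib, key]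
  simp [Finset.mul_sum]

theorem euler_commutator_norm_sq (hXX : ∀ i j, X i * X j = X j * X i)
    (hDX : ∀ i j, D i * X j = X j * D i + if i = j then 1 else 0) :
    (∑ i, X i * D i) * (∑ j, X j * X j) - (∑ j, X j * X j) * (∑ i, X i * D i) =
      2 * ∑ i, X i * X i := by
  have key : ∀ i j, X i * D i * (X j * X j) - X j * X j * (X i * D i) =
      if i = j then 2 * (X i * X i) else 0 := by
    intro i j
    have h : X i * D i * (X j * X j) = X j * X j * (X i * D i) +
        2 * (if i = j then X i * X j else 0) := by
      calc X i * D i * (X j * X j) = X i * (D i * X j) * X j := by noncomm_ring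
        _ = X i * (X j * D i + if i = j then 1 else 0) * X j := by rw [hDX]
        _ = X i * X j * (D i * X j) + X i * (if i = j then 1 else 0) * X j := by
            split_ifs <;> noncomm_ring
        _ = X i * X j * X j * D i + X i * X j * (if i = j then 1 else 0) +
            X i * (if i = j then 1 else 0) * X j := by rw [hDX]; split_ifs <;> noncomm_ring
        _ = X j * X j * (X i * D i) + X i * X j * (if i = j then 1 else 0) +
            X i * (if i = j then 1 else 0) * X j := by
            rw [hXX i j, mul_assoc (X j) (X i) (X j), hXX i j]; noncomm_ring
        _ = _ := by split_ifs <;> noncomm_ring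
    rw [h]
    by_cases hij : i = j
    · subst hij; simp
    · simp [hij]
  rw [Finset.sum_mul_sum, Finset.sum_mul_sum, Finset.sum_comm, ← Finset.sum_sub_distrib]
  simp_rw [← Finset.sum_sub_distrib, key]
  simp [Finset.mul_sum]

theorem coord_commutator_laplacian
    (hDX : ∀ i j, D i * X j = X j * D i + if i = j then 1 else 0) (i : Fin n) :
    X i * (∑ j, D j * D j) - (∑ j, D j * D j) * X i = -(2 * D i) := by
  have key : ∀ j, X i * (D j * D j) - D j * D j * X i = if j = i then -(2 * D j) else 0 := by
    intro j
    have h : D j * D j * X i = X i * (D j * D j) + 2 * (if j = i then D j else 0) := by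
      calc D j * D j * X i = D j * (D j * X i) := by noncomm_ring
        _ = D j * (X i * D j + if j = i then 1 else 0) := by rw [hDX]
        _ = (D j * X i) * D j + D j * (if j = i then 1 else 0) := by
            split_ifs <;> noncomm_ring
        _ = X i * (D j * D j) + (if j = i then 1 else 0) * D j + D j * (if j = i then 1 else 0) := by
            rw [hDX]; split_ifs <;> noncomm_ring
        _ = _ := by split_ifs <;> noncomm_ring
    rw [h]
    split_ifs <;> simp
  rw [Finset.mul_sum, Finset.sum_mul, ← Finset.sum_sub_distrib]
  simp_rw [key]
  simp

theorem norm_sq_commutator_laplacian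
    (hDX : ∀ i j, D i * X j = X j * D i + if i = j then 1 else 0) :
    (∑ i, X i * X i) * (∑ j, D j * D j) - (∑ j, D j * D j) * (∑ i, X i * X i) =
      -(4 * ∑ i, X i * D i) - 2 * n := by
  have key : ∀ i, X i * X i * (∑ j, D j * D j) - (∑ j, D j * D j) * (X i * X i) =
      -(4 * (X i * D i)) - 2 := by
    intro i
    have h := coord_commutator_laplacian hDX i
    have h2 := hDX i i
    rw [if_pos rfl] at h2
    calc _ = X i * (X i * (∑ j, D j * D j) - (∑ j, D j * D j) * X i) +
          (X i * (∑ j, D j * D j) - (∑ j, D j * D j) * X i) * X i := by noncomm_ring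
      _ = -(2 * (X i * D i)) - 2 * (D i * X i) := by rw [h]; noncomm_ring
      _ = _ := by rw [h2, ← one_add_one_eq_two]; noncomm_ring
  have h : ∀ B : R, (∑ i, X i * X i) * B - B * (∑ i, X i * X i) =
      ∑ i, (X i * X i * B - B * (X i * X i)) := by
    intro B
    rw [Finset.mul_sum, Finset.sum_mul, ← Finset.sum_sub_distrib]
  rw [h, Finset.sum_congr rfl fun i _ => key i]
  simp [Finset.mul_sum, (Nat.cast_commute n (2 : R)).eq]

end Weyl

section Schwartz

variable {n : ℕ}

/-- The `i`-th partial derivative as an operator on Schwartz functions. -/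
noncomputable def schwartzPd (i : Fin n) : Module.End ℂ 𝓢(Fin n → ℝ, ℂ) :=
  (LineDeriv.lineDerivOpCLM ℂ 𝓢(Fin n → ℝ, ℂ) (Pi.single i (1 : ℝ) : Fin n → ℝ)).toLinearMap

/-- Multiplication by `x i + v i` as an operator on Schwartz functions. -/
noncomputable def schwartzCoord (v : Fin n → ℝ) (i : Fin n) : Module.End ℂ 𝓢(Fin n → ℝ, ℂ) :=
  (SchwartzMap.smulLeftCLM ℂ (fun x : Fin n → ℝ => ((x i + v i : ℝ) : ℂ))).toLinearMap

theorem schwartzCoord_apply (v : Fin n → ℝ) (i : Fin n) (f : 𝓢(Fin n → ℝ, ℂ)) (x : Fin n → ℝ) :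
    schwartzCoord v i f x = ((x i + v i : ℝ) : ℂ) * f x := by
  have h1 : Function.HasTemperateGrowth (fun x : Fin n → ℝ => x i) :=
    (ContinuousLinearMap.proj (R := ℝ) (φ := fun _ : Fin n => ℝ) i).hasTemperateGrowth
  have h2 : Function.HasTemperateGrowth (fun x : Fin n → ℝ => ((x i + v i : ℝ) : ℂ)) :=
    Function.HasTemperateGrowth.comp (g := Complex.ofReal) (by fun_prop) (h1.add (.const (v i)))
  exact SchwartzMap.smulLeftCLM_apply_apply h2 f x

theorem schwartzPd_apply_fderiv (i : Fin n) (f : 𝓢(Fin n → ℝ, ℂ)) (x : Fin n → ℝ) :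
    schwartzPd i f x = fderiv ℝ f x (Pi.single i 1) :=
  SchwartzMap.lineDerivOp_apply_eq_fderiv _ f x

theorem pd_eq_fderiv {f : (Fin n → ℝ) → ℂ} {x : Fin n → ℝ} (hf : DifferentiableAt ℝ f x)
    (i : Fin n) : pd n i f x = fderiv ℝ f x (Pi.single i 1) := by
  have h1 := hasDerivAt_update x i (x i)
  have h2 : HasFDerivAt f (fderiv ℝ f x) (Function.update x i (x i)) := by
    rw [Function.update_eq_self]; exact hf.hasFDerivAt
  exact (h2.comp_hasDerivAt (x i) h1).deriv

theorem pd_schwartz (i : Fin n) (f : 𝓢(Fin n → ℝ, ℂ)) : pd n i f = schwartzPd i f := by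
  ext x
  rw [schwartzPd_apply_fderiv, pd_eq_fderiv f.differentiableAt]

theorem lap_schwartz (f : 𝓢(Fin n → ℝ, ℂ)) :
    lap n f = (∑ i, schwartzPd i * schwartzPd i : Module.End ℂ 𝓢(Fin n → ℝ, ℂ)) f := by
  ext x
  simp [lap, pd_schwartz]

theorem schwartzCoord_comm (v : Fin n → ℝ) (i j : Fin n) :
    schwartzCoord v i * schwartzCoord v j = schwartzCoord v j * schwartzCoord v i := by
  ext f x
  simp only [Module.End.mul_apply, schwartzCoord_apply]
  ring

theorem schwartzPd_comm (i j : Fin n) :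
    schwartzPd i * schwartzPd j = schwartzPd j * schwartzPd i := by
  ext f x
  have h1 : ContDiffAt ℝ 2 f x := (f.smooth 2).contDiffAt
  have h2 : DifferentiableAt ℝ (fderiv ℝ f) x :=
    (h1.fderiv_right (m := 1) (by norm_num)).differentiableAt (by norm_num)
  have h3 : ∀ k l : Fin n, schwartzPd k (schwartzPd l f) x =
      fderiv ℝ (fderiv ℝ f) x (Pi.single k 1) (Pi.single l 1) := by
    intro k l
    have h4 : (schwartzPd l f : (Fin n → ℝ) → ℂ) = fun y => fderiv ℝ f y (Pi.single l 1) := by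
      ext y; exact schwartzPd_apply_fderiv l f y
    rw [schwartzPd_apply_fderiv, h4, fderiv_clm_apply h2 (by fun_prop)]
    simp
  rw [Module.End.mul_apply, Module.End.mul_apply, h3, h3]
  exact h1.isSymmSndFDerivAt (by simp) _ _

theorem schwartzPd_mul_schwartzCoord (v : Fin n → ℝ) (i j : Fin n) :
    schwartzPd i * schwartzCoord v j =
      schwartzCoord v j * schwartzPd i + if i = j then 1 else 0 := by
  ext f x
  have h1 : HasFDerivAt (fun x : Fin n → ℝ => ((x j + v j : ℝ) : ℂ))
      (Complex.ofRealCLM.comp (ContinuousLinearMap.proj (R := ℝ) (φ := fun _ : Fin n => ℝ) j)) x :=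
    Complex.ofRealCLM.hasFDerivAt.comp x
      (((ContinuousLinearMap.proj (R := ℝ) (φ := fun _ : Fin n => ℝ) j).hasFDerivAt).add_const _)
  have h2 := h1.mul (f.differentiableAt (x := x)).hasFDerivAt
  have h3 : (schwartzCoord v j f : (Fin n → ℝ) → ℂ) = fun x => ((x j + v j : ℝ) : ℂ) * f x := by
    ext x; exact schwartzCoord_apply v j f x
  rw [Module.End.mul_apply, schwartzPd_apply_fderiv, h3]
  have h4 := congrArg (fun L => L (Pi.single i 1)) h2.fderiv
  refine h4.trans ?_
  rw [LinearMap.add_apply, add_apply, Module.End.mul_apply]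
  change _ = schwartzCoord v j (schwartzPd i f) x + _
  rw [schwartzCoord_apply, schwartzPd_apply_fderiv]
  by_cases hij : i = j
  · subst hij; simp
  · simp [hij, Ne.symm hij]

end Schwartz

theorem conjugated_commutator {R : Type*} [Ring R] [Algebra ℂ R] {n : ℕ} {X D : Fin n → R}
    (hXX : ∀ i j, X i * X j = X j * X i) (hDD : ∀ i j, D i * D j = D j * D i)
    (hDX : ∀ i j, D i * X j = X j * D i + if i = j then 1 else 0)
    (s₀ s₁ s₂ k m : ℂ) (c : Fin n → ℂ) {S A : R}
    (hS : S = s₁ • (∑ i, X i * D i) + s₂ • (∑ i, X i * X i) + (∑ i, c i • X i) + s₀ • 1)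
    (hA : A = k • ((∑ i, D i * D i) + m • ∑ i, X i * X i)) :
    S * A - A * S = ∑ i, ((-2 * k * s₁) • (D i * D i) + (2 * k * m * s₁) • (X i * X i) +
      (-4 * k * s₂) • (X i * D i) + (-2 * k * s₂) • 1 + (-2 * k * c i) • D i) := by
  have h1 := euler_commutator_laplacian hDD hDX
  have h2 := euler_commutator_norm_sq hXX hDX
  have h3 := norm_sq_commutator_laplacian hDX
  have h4 : (∑ i, c i • X i) * (∑ j, D j * D j) - (∑ j, D j * D j) * (∑ i, c i • X i) =
      (-2 : ℂ) • ∑ i, c i • D i := by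
    rw [Finset.sum_mul, Finset.mul_sum, ← Finset.sum_sub_distrib, Finset.smul_sum]
    refine Finset.sum_congr rfl fun i _ => ?_
    rw [smul_mul_assoc, mul_smul_comm, ← smul_sub, coord_commutator_laplacian hDX i, two_mul]
    module
  have h5 : (∑ i, c i • X i) * (∑ j, X j * X j) = (∑ j, X j * X j) * (∑ i, c i • X i) := by
    refine Commute.sum_left _ _ _ fun i _ => Commute.smul_left (Commute.sum_right _ _ _ fun j _ => ?_) _
    exact Commute.mul_right (hXX i j) (hXX i j)
  have h6 : ∑ i, ((-2 * k * s₁) • (D i * D i) + (2 * k * m * s₁) • (X i * X i) +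
      (-4 * k * s₂) • (X i * D i) + (-2 * k * s₂) • (1 : R) + (-2 * k * c i) • D i) =
      (-2 * k * s₁) • (∑ i, D i * D i) + (2 * k * m * s₁) • (∑ i, X i * X i) +
      (-4 * k * s₂) • (∑ i, X i * D i) + (-2 * k * s₂) • (n : R) +
      (-2 * k) • ∑ i, c i • D i := by
    simp only [Finset.sum_add_distrib, Finset.smul_sum, smul_smul]
    simp [smul_comm n]
  rw [h6, hS, hA]
  clear h6 hS hA
  rw [show (2 : R) * ∑ i, D i * D i = (2 : ℂ) • ∑ i, D i * D i by rw [two_mul, two_smul]] at h1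
  rw [show (2 : R) * ∑ i, X i * X i = (2 : ℂ) • ∑ i, X i * X i by rw [two_mul, two_smul]] at h2
  rw [show (4 : R) * ∑ i, X i * D i = (4 : ℂ) • ∑ i, X i * D i by
    rw [Algebra.smul_def, map_ofNat],
    show (2 : R) * n = (2 : ℂ) • (n : R) by rw [two_mul, two_smul]] at h3
  simp only [add_mul, mul_add, smul_mul_assoc, mul_smul_comm, smul_add, smul_smul, one_mul,
    mul_one]
  linear_combination (norm := module) (k * s₁) • h1 + (k * s₁ * m) • h2 + (k * s₂) • h3 + k • h4 +
    (k * m) • h5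

theorem integral_inner_schwartzPd_schwartzPd {n : ℕ} (f : 𝓢(Fin n → ℝ, ℂ)) (i : Fin n) :
    ∫ x, inner ℝ (f x) (schwartzPd i (schwartzPd i f) x) = -∫ x, ‖schwartzPd i f x‖ ^ 2 := by
  have h := SchwartzMap.integral_bilinear_lineDerivOp_right_eq_neg_left (μ := volume) f
    (schwartzPd i f) (innerSL ℝ) (Pi.single i 1)
  refine h.trans ?_
  congr 1
  refine integral_congr_ae (.of_forall fun x => ?_)
  exact real_inner_self_eq_norm_sq (schwartzPd i f x)

theorem integrable_inner_schwartz {n : ℕ} (f g : 𝓢(Fin n → ℝ, ℂ)) :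
    Integrable fun x => inner ℝ (f x) (g x) :=
  (SchwartzMap.pairing (innerSL ℝ) f g).integrable

theorem integrable_mul_conj_schwartz {n : ℕ} (f g : 𝓢(Fin n → ℝ, ℂ)) :
    Integrable fun x => g x * starRingEnd ℂ (f x) :=
  (g.memLp 2).integrable_mul (f.memLp 2).star

theorem re_integral_mul_conj_ge {n : ℕ} (f g : 𝓢(Fin n → ℝ, ℂ)) (K μ : ℝ)
    (h : ∀ x, -K * ‖f x‖ ^ 2 - μ * ∑ i, (inner ℝ (f x) (schwartzPd i (schwartzPd i f) x) +
      ‖schwartzPd i f x‖ ^ 2) ≤ (g x * starRingEnd ℂ (f x)).re) :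
    -K * ∫ x, ‖f x‖ ^ 2 ≤ (∫ x, g x * starRingEnd ℂ (f x)).re := by
  have hn : ∀ u : 𝓢(Fin n → ℝ, ℂ), Integrable fun x => ‖u x‖ ^ 2 := fun u => by
    simpa only [real_inner_self_eq_norm_sq] using integrable_inner_schwartz u u
  have hi : ∀ i, Integrable fun x => inner ℝ (f x) (schwartzPd i (schwartzPd i f) x) +
      ‖schwartzPd i f x‖ ^ 2 := fun i => (integrable_inner_schwartz _ _).add (hn _)
  have hs := integrable_finsetSum Finset.univ fun i _ => hi i
  have hg := integrable_mul_conj_schwartz f g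
  have h0 : ∫ x, ∑ i, (inner ℝ (f x) (schwartzPd i (schwartzPd i f) x) +
      ‖schwartzPd i f x‖ ^ 2) = 0 := by
    rw [integral_finsetSum _ fun i _ => hi i]
    refine Finset.sum_eq_zero fun i _ => ?_
    rw [integral_add (integrable_inner_schwartz _ _) (hn _),
      integral_inner_schwartzPd_schwartzPd, neg_add_cancel]
  have h1 := integral_mono (((hn f).const_mul (-K)).sub (hs.const_mul μ)) hg.re h
  have h2 := integral_sub ((hn f).const_mul (-K)) (hs.const_mul μ)
  rw [integral_const_mul, integral_const_mul, h0, mul_zero, sub_zero] at h2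
  rw [← h2]
  refine h1.trans_eq ?_
  exact integral_re hg

theorem conjugated_symbol_lower_bound {a a' a'' g g' β β₂ y F : ℝ} (ha : 0 < a) (hg : 0 < g)
    (hF : F = g * (a'' + 32 * a ^ 3 - 3 * a' ^ 2 / (2 * a) - (a / 2) * (a' / a + g' / g) ^ 2))
    (hFpos : 0 < F) (f p q : ℂ) :
    -(g ^ 2 * a ^ 2 * β₂ ^ 2 / F) * ‖f‖ ^ 2 - 8 * a * g * (inner ℝ f q + ‖p‖ ^ 2) ≤
      ((-8 * a * g * q - 8 * Complex.I * a * g * β * p -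
        (8 * a' * g + 4 * a * g') * Complex.I * (y * p + f / 2) +
        ((g * a'' + 32 * g * a ^ 3 + g' * a') * y ^ 2 + (4 * g * a' + 2 * a * g') * β * y +
          2 * a * g * β₂ * y + 2 * a * g * β ^ 2) * f) * starRingEnd ℂ f).re := by
  have hQ : F * y ^ 2 + 2 * a * g * β₂ * y + g ^ 2 * a ^ 2 * β₂ ^ 2 / F =
      (F * y + a * g * β₂) ^ 2 / F := by field_simp; ring
  have hQ0 : 0 ≤ (F * y + a * g * β₂) ^ 2 / F := by positivity
  obtain ⟨r, rfl⟩ : ∃ r, a' = r * a := ⟨a' / a, by field_simp⟩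
  obtain ⟨s, rfl⟩ : ∃ s, g' = s * g := ⟨g' / g, by field_simp⟩
  have hF' : g * a'' = F - 32 * g * a ^ 3 + g * a * (3 * r ^ 2 / 2 + (r + s) ^ 2 / 2) := by
    rw [hF]; field_simp; ring
  set w := β / 2 + (r / 2 + s / 4) * y with hw
  have h1 : 0 ≤ 8 * a * g * ((p.re - w * f.im) ^ 2 + (p.im + w * f.re) ^ 2) +
      (F * y + a * g * β₂) ^ 2 / F * (f.re ^ 2 + f.im ^ 2) := by positivity
  rw [← hQ] at h1
  rw [← sub_nonneg]
  refine h1.trans_eq ?_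
  rw [← Complex.normSq_eq_norm_sq, ← Complex.normSq_eq_norm_sq, Complex.normSq_apply,
    Complex.normSq_apply, Complex.inner]
  generalize hK : g ^ 2 * a ^ 2 * β₂ ^ 2 / F = K
  have h2 : ((g : ℂ) * a'') = ((g * a'' : ℝ) : ℂ) := by push_cast; rfl
  rw [h2, hF', hw]
  simp [pow_succ]
  ring

/-- Lower bound for the self-adjoint operator `γS_t + γ[S,A] + γ̇S`: if
`F(a,γ) = γ(ä + 32a³ - 3ȧ²/(2a) - (a/2)(ȧ/a + γ̇/γ)²) > 0` on `[c,d]`, then for every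
Schwartz `f` and `t ∈ [c,d]`,
`⟨γS_t f + γ[S,A]f + γ̇Sf, f⟩ ≥ -(γ²a²|b̈|²/F(a,γ)) ‖f‖²`. -/
theorem stmt12 (n : ℕ) (c d : ℝ) (hcd : c < d)
    (a γ : ℝ → ℝ) (b : ℝ → Fin n → ℝ)
    (ha : ContDiff ℝ (⊤ : ℕ∞) a) (hγ : ContDiff ℝ (⊤ : ℕ∞) γ) (hb : ContDiff ℝ (⊤ : ℕ∞) b)
    (hapos : ∀ t ∈ Icc c d, 0 < a t) (hγpos : ∀ t ∈ Icc c d, 0 < γ t)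
    (Fval : ℝ → ℝ)
    (hFval : ∀ t : ℝ, Fval t =
      γ t * (deriv (deriv a) t + 32 * (a t) ^ 3 - 3 * (deriv a t) ^ 2 / (2 * a t) -
        (a t / 2) * (deriv a t / a t + deriv γ t / γ t) ^ 2))
    (hFpos : ∀ t ∈ Icc c d, 0 < Fval t)
    (S A : ℝ → ((Fin n → ℝ) → ℂ) → (Fin n → ℝ) → ℂ)
    (hS : ∀ (t : ℝ) (f : (Fin n → ℝ) → ℂ) (x : Fin n → ℝ), S t f x =
      -2 * Complex.I * (2 * ((a t : ℝ) : ℂ) * (∑ i, ((x i + b t i : ℝ) : ℂ) * pd n i f x) +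
          ((a t : ℝ) : ℂ) * (n : ℂ) * f x) +
        ((deriv a t : ℝ) : ℂ) * ((∑ i, (x i + b t i) ^ 2 : ℝ) : ℂ) * f x +
        2 * ((a t : ℝ) : ℂ) * ((∑ i, deriv b t i * (x i + b t i) : ℝ) : ℂ) * f x)
    (hA : ∀ (t : ℝ) (f : (Fin n → ℝ) → ℂ) (x : Fin n → ℝ), A t f x =
      Complex.I * (lap n f x +
        4 * (((a t) ^ 2 : ℝ) : ℂ) * ((∑ i, (x i + b t i) ^ 2 : ℝ) : ℂ) * f x)) :
    ∀ (f : SchwartzMap (Fin n → ℝ) ℂ), ∀ t ∈ Icc c d,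
      (∫ x : Fin n → ℝ,
          (((γ t : ℝ) : ℂ) * deriv (fun τ => S τ (⇑f) x) t +
            ((γ t : ℝ) : ℂ) * (S t (A t ⇑f) x - A t (S t ⇑f) x) +
            ((deriv γ t : ℝ) : ℂ) * S t (⇑f) x) * (starRingEnd ℂ) (f x)).re ≥
        -((γ t) ^ 2 * (a t) ^ 2 * (∑ i, (deriv (deriv b) t i) ^ 2) / Fval t) *
          ∫ x : Fin n → ℝ, ‖f x‖ ^ 2 := by
  intro f t ht
  have ha0 := hapos t ht
  have hg0 := hγpos t ht
  have hF0 := hFpos t ht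
  have hFt := hFval t
  set X := schwartzCoord (b t) with hX
  set D := schwartzPd (n := n) with hD
  obtain ⟨T, hT⟩ : ∃ T : Module.End ℂ 𝓢(Fin n → ℝ, ℂ), T =
      (-4 * Complex.I * a t) • (∑ i, X i * D i) + ((deriv a t : ℝ) : ℂ) • (∑ i, X i * X i) +
      (∑ i, (2 * a t * deriv b t i : ℂ) • X i) + (-2 * Complex.I * a t * n) • 1 := ⟨_, rfl⟩
  obtain ⟨B, hB⟩ : ∃ B : Module.End ℂ 𝓢(Fin n → ℝ, ℂ), B =
      Complex.I • ((∑ i, D i * D i) + (4 * (a t : ℂ) ^ 2) • ∑ i, X i * X i) := ⟨_, rfl⟩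
  have hn : (n : ℂ) = ∑ _i : Fin n, (1 : ℂ) := by simp
  have hST : ∀ u : 𝓢(Fin n → ℝ, ℂ), S t u = T u := by
    intro u
    ext x
    rw [hS, hT]
    simp only [LinearMap.add_apply, LinearMap.smul_apply, LinearMap.sum_apply, add_apply,
      smul_apply, sum_apply, Module.End.mul_apply, Module.End.one_apply, smul_eq_mul, hX,
      schwartzCoord_apply, pd_schwartz, ← hD]
    push_cast
    rw [hn]
    simp only [Finset.mul_sum, Finset.sum_mul, ← Finset.sum_add_distrib]
    refine Finset.sum_congr rfl fun i _ => ?_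
    ring
  have hAB : ∀ u : 𝓢(Fin n → ℝ, ℂ), A t u = B u := by
    intro u
    ext x
    rw [hA, hB, lap_schwartz]
    simp only [LinearMap.add_apply, LinearMap.smul_apply, LinearMap.sum_apply, add_apply,
      smul_apply, sum_apply, Module.End.mul_apply, smul_eq_mul, hX,
      schwartzCoord_apply, ← hD]
    push_cast
    simp only [Finset.mul_sum, Finset.sum_mul, mul_add]
    congr 1
    refine Finset.sum_congr rfl fun i _ => ?_
    ring
  have hcomm := conjugated_commutator (schwartzCoord_comm (b t)) schwartzPd_comm
    (schwartzPd_mul_schwartzCoord (b t)) _ _ _ _ _ _ hT hB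
  have hSsum : ∀ τ x, S τ f x = ∑ i, (-4 * Complex.I * (a τ * ((x i + b τ i : ℝ) : ℂ)) * D i f x -
      2 * Complex.I * a τ * f x + ((deriv a τ : ℝ) : ℂ) * ((x i + b τ i : ℝ) : ℂ) ^ 2 * f x +
      2 * (a τ * ((deriv b τ i * (x i + b τ i) : ℝ) : ℂ)) * f x) := by
    intro τ x
    rw [hS]
    simp only [pd_schwartz, ← hD]
    push_cast
    rw [hn]
    simp only [Finset.mul_sum, Finset.sum_mul, ← Finset.sum_add_distrib]
    refine Finset.sum_congr rfl fun i _ => ?_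
    ring
  have hderiv : ∀ x, HasDerivAt (fun τ => S τ f x)
      (∑ i, (-4 * Complex.I * (deriv a t * ((x i + b t i : ℝ) : ℂ) + a t * ((deriv b t i : ℝ) : ℂ)) *
          D i f x - 2 * Complex.I * deriv a t * f x +
        (((deriv (deriv a) t : ℝ) : ℂ) * ((x i + b t i : ℝ) : ℂ) ^ 2 +
          deriv a t * (2 * ((x i + b t i : ℝ) : ℂ) * deriv b t i)) * f x +
        2 * (deriv a t * ((deriv b t i * (x i + b t i) : ℝ) : ℂ) +
          a t * ((deriv (deriv b) t i * (x i + b t i) + deriv b t i * deriv b t i : ℝ) : ℂ)) *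
          f x)) t := by
    intro x
    simp_rw [hSsum]
    have ha1 : HasDerivAt (fun τ => (a τ : ℂ)) ((deriv a t : ℝ) : ℂ) t :=
      ((ha.differentiable (by simp)) t).hasDerivAt.ofReal_comp
    have ha2 : HasDerivAt (fun τ => ((deriv a τ : ℝ) : ℂ)) ((deriv (deriv a) t : ℝ) : ℂ) t :=
      (((contDiff_infty_iff_deriv.1 ha).2.differentiable (by simp)) t).hasDerivAt.ofReal_comp
    refine HasDerivAt.fun_sum fun i _ => ?_
    have hb0 : HasDerivAt (fun τ => x i + b τ i) (deriv b t i) t :=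
      (hasDerivAt_pi.1 ((hb.differentiable (by simp)) t).hasDerivAt i).const_add _
    have hb1 := hb0.ofReal_comp
    have hb2 : HasDerivAt (fun τ => deriv b τ i) (deriv (deriv b) t i) t :=
      hasDerivAt_pi.1 (((contDiff_infty_iff_deriv.1 hb).2.differentiable (by simp)) t).hasDerivAt i
    have hb3 := (hb2.mul hb0).ofReal_comp
    have h := (((((ha1.mul hb1).const_mul (-4 * Complex.I)).mul_const (D i f x)).sub
      ((ha1.const_mul (2 * Complex.I)).mul_const (f x))).add
      ((ha2.mul (hb1.pow 2)).mul_const (f x))).add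
      (((ha1.mul hb3).const_mul 2).mul_const (f x))
    refine h.congr_deriv ?_
    simp
  obtain ⟨G, hG⟩ : ∃ G : 𝓢(Fin n → ℝ, ℂ), G = ∑ i, (
      (-8 * a t * γ t : ℂ) • D i (D i f) - (8 * Complex.I * a t * γ t * deriv b t i) • D i f -
      ((8 * deriv a t * γ t + 4 * a t * deriv γ t) * Complex.I) • (X i (D i f) + (2⁻¹ : ℂ) • f) +
      (γ t * deriv (deriv a) t + 32 * γ t * a t ^ 3 + deriv γ t * deriv a t : ℂ) • X i (X i f) +
      ((4 * γ t * deriv a t + 2 * a t * deriv γ t) * deriv b t i : ℂ) • X i f +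
      (2 * a t * γ t * deriv (deriv b) t i : ℂ) • X i f +
      (2 * a t * γ t * deriv b t i ^ 2 : ℂ) • f) := ⟨_, rfl⟩
  have hGx : ∀ x, ((γ t : ℝ) : ℂ) * deriv (fun τ => S τ f x) t +
      ((γ t : ℝ) : ℂ) * (S t (A t f) x - A t (S t f) x) +
      ((deriv γ t : ℝ) : ℂ) * S t f x = G x := by
    intro x
    have h1 : S t (A t f) x - A t (S t f) x = (T * B - B * T) f x := by
      rw [hAB, hST, hST, hAB]
      rfl
    rw [(hderiv x).deriv, h1, hcomm, hSsum, hG]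
    simp only [LinearMap.add_apply, LinearMap.smul_apply, LinearMap.sum_apply, add_apply,
      sub_apply, smul_apply, sum_apply, Module.End.mul_apply, Module.End.one_apply, smul_eq_mul,
      hX, schwartzCoord_apply, ← hD, Finset.mul_sum, ← Finset.sum_add_distrib]
    refine Finset.sum_congr rfl fun i _ => ?_
    push_cast
    ring_nf
    simp only [Complex.I_sq]
    ring
  simp_rw [hGx]
  refine re_integral_mul_conj_ge f G _ (8 * a t * γ t) fun x => ?_
  rw [hG]
  simp only [add_apply, sub_apply, smul_apply, sum_apply, smul_eq_mul, hX, schwartzCoord_apply]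
  rw [Finset.sum_mul, Complex.re_sum, Finset.mul_sum, Finset.sum_div, ← Finset.sum_neg_distrib,
    Finset.sum_mul, Finset.mul_sum, ← Finset.sum_sub_distrib]
  refine Finset.sum_le_sum fun i _ => ?_
  refine (conjugated_symbol_lower_bound (β := deriv b t i) (β₂ := deriv (deriv b) t i)
    (y := x i + b t i) ha0 hg0 hFt hF0 (f x) (D i f x) (D i (D i f) x)).trans_eq ?_
  congr 2
  push_cast
  ring
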